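/- The even hyperbolic lattice U ⊕ D₄ ⊕ A₁⁷ (the 2-elementary lattice with invariants (r,a,δ) = (13,9,1)) is reflective: the subgroup W_r of O(S) generated by reflections in all roots has finite index in O(S). -/

import Mathlib

open Matrix

/-- The bilinear form on `ℤⁿ` associated to a Gram matrix `G`. -/
def bform {n : ℕ} (G : Matrix (Fin n) (Fin n) ℤ) (x y : Fin n → ℤ) : ℤ :=
  x ⬝ᵥ G.mulVec y

/-- The orthogonal group `O(S)` of the lattice with Gram matrix `G`:
all `ℤ`-module automorphisms preserving the bilinear form. -/
def OrthGroup (n : ℕ) (G : Matrix (Fin n) (Fin n) ℤ) :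
    Subgroup ((Fin n → ℤ) ≃ₗ[ℤ] (Fin n → ℤ)) where
  carrier := {f | ∀ x y, bform G (f x) (f y) = bform G x y}
  one_mem' := fun _ _ => rfl
  mul_mem' := by
    intro f g hf hg x y
    exact (hf (g x) (g y)).trans (hg x y)
  inv_mem' := by
    intro f hf x y
    have h := (hf (f⁻¹ x) (f⁻¹ y)).symm
    rwa [show f (f⁻¹ x) = x from f.apply_symm_apply x,
      show f (f⁻¹ y) = y from f.apply_symm_apply y] at h

/-- A root: a vector of square `-2`, or of square `-4` whose pairing with
the whole lattice is even. -/
def IsRoot {n : ℕ} (G : Matrix (Fin n) (Fin n) ℤ) (α : Fin n → ℤ) : Prop :=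
  bform G α α = -2 ∨ (bform G α α = -4 ∧ ∀ x : Fin n → ℤ, (2 : ℤ) ∣ bform G α x)

/-- `f` is the reflection in a root `α`. -/
def IsReflection {n : ℕ} (G : Matrix (Fin n) (Fin n) ℤ)
    (f : (Fin n → ℤ) ≃ₗ[ℤ] (Fin n → ℤ)) : Prop :=
  ∃ α : Fin n → ℤ, IsRoot G α ∧
    ∀ x : Fin n → ℤ, f x = x - ((2 * bform G x α) / bform G α α) • α

/-- The subgroup `W_r` of `O(S)` generated by the reflections in all roots. -/
def Wr (n : ℕ) (G : Matrix (Fin n) (Fin n) ℤ) : Subgroup ↥(OrthGroup n G) :=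
  Subgroup.closure {f | IsReflection G f.val}

open Matrix

/-- Orthogonal direct sum of two Gram matrices. -/
def dsum {m k : ℕ} (A : Matrix (Fin m) (Fin m) ℤ) (B : Matrix (Fin k) (Fin k) ℤ) :
    Matrix (Fin (m + k)) (Fin (m + k)) ℤ :=
  Matrix.reindex finSumFinEquiv finSumFinEquiv (Matrix.fromBlocks A 0 0 B)

/-- Gram matrix of the hyperbolic plane `U`. -/
def gramU : Matrix (Fin 2) (Fin 2) ℤ := !![0, 1; 1, 0]

/-- Gram matrix of `A₁ = ⟨-2⟩`. -/
def gramA1 : Matrix (Fin 1) (Fin 1) ℤ := !![-2]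

/-- Gram matrix (= negative Cartan matrix) of a simply laced root lattice with
given Dynkin diagram edges. -/
def adjGram (n : ℕ) (E : List (ℕ × ℕ)) : Matrix (Fin n) (Fin n) ℤ :=
  Matrix.of fun i j =>
    if i = j then -2 else if (i.1, j.1) ∈ E ∨ (j.1, i.1) ∈ E then 1 else 0

/-- Gram matrix of the negative definite root lattice `Dₙ`
(in the root basis `e₁+e₂, e₂-e₁, e₃-e₂, …, eₙ-eₙ₋₁` of `{x ∈ ℤⁿ : Σxᵢ even}`
with the negative of the standard Euclidean form). -/
def gramD (n : ℕ) : Matrix (Fin n) (Fin n) ℤ :=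
  adjGram n ((0, 2) :: (List.range (n - 2)).map fun k => (k + 1, k + 2))

/-- Gram matrix (negative Cartan matrix) of `E₈`. -/
def gramE8 : Matrix (Fin 8) (Fin 8) ℤ :=
  adjGram 8 [(0, 2), (1, 3), (2, 3), (3, 4), (4, 5), (5, 6), (6, 7)]

/-- Gram matrix (negative Cartan matrix) of `E₇`. -/
def gramE7 : Matrix (Fin 7) (Fin 7) ℤ :=
  adjGram 7 [(0, 2), (1, 3), (2, 3), (3, 4), (4, 5), (5, 6)]

/-- The Gram matrix of the even 2-elementary hyperbolic lattice `U ⊕ D₄ ⊕ A₁⁷`,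
with invariants `(r,a,δ) = (13,9,1)`. -/
def gramS :=
  dsum gramU (dsum (gramD 4) (dsum gramA1 (dsum gramA1 (dsum gramA1 (dsum gramA1 (dsum gramA1 (dsum gramA1 gramA1)))))))

section General

variable {n : ℕ} {G : Matrix (Fin n) (Fin n) ℤ}

theorem bform_add_left (x y z : Fin n → ℤ) : bform G (x + y) z = bform G x z + bform G y z :=
  add_dotProduct x y _

theorem bform_smul_left (c : ℤ) (x y : Fin n → ℤ) : bform G (c • x) y = c * bform G x y :=
  smul_dotProduct c x _

theorem bform_sub_left (x y z : Fin n → ℤ) : bform G (x - y) z = bform G x z - bform G y z :=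
  sub_dotProduct x y _

theorem bform_neg_left (x y : Fin n → ℤ) : bform G (-x) y = -bform G x y :=
  neg_dotProduct x _

theorem bform_comm (hG : G.IsSymm) (x y : Fin n → ℤ) : bform G x y = bform G y x := by
  rw [bform, bform, dotProduct_mulVec, ← mulVec_transpose, hG.eq, dotProduct_comm]

theorem isRoot_of_norm_eq_neg_four {α : Fin n → ℤ} (h : bform G α α = -4)
    (hα : ∀ i, (2 : ℤ) ∣ (α ᵥ* G) i) : IsRoot G α := by
  refine Or.inr ⟨h, fun x => ?_⟩
  rw [bform, dotProduct_mulVec]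
  exact Finset.dvd_sum fun i _ => (hα i).mul_right _

theorem IsRoot.norm_ne_zero {α : Fin n → ℤ} (hα : IsRoot G α) : bform G α α ≠ 0 := by
  rcases hα with h | ⟨h, -⟩ <;> rw [h] <;> decide

theorem IsRoot.norm_neg {α : Fin n → ℤ} (hα : IsRoot G α) : bform G α α < 0 := by
  rcases hα with h | ⟨h, -⟩ <;> rw [h] <;> decide

theorem IsRoot.norm_dvd (hG : G.IsSymm) {α : Fin n → ℤ} (hα : IsRoot G α) (x : Fin n → ℤ) :
    bform G α α ∣ 2 * bform G x α := by
  rcases hα with h | ⟨h, h'⟩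
  · rw [h, neg_dvd]; exact dvd_mul_right 2 _
  · have := h' x
    rw [bform_comm hG] at this
    rw [h, neg_dvd]; exact mul_dvd_mul_left 2 this

/-- The coroot `2⟨x, α⟩ / ⟨α, α⟩` of a root `α`, as a linear form. -/
def IsRoot.coroot (hG : G.IsSymm) {α : Fin n → ℤ} (hα : IsRoot G α) :
    Module.Dual ℤ (Fin n → ℤ) where
  toFun x := 2 * bform G x α / bform G α α
  map_add' x y := by
    rw [bform_add_left, mul_add, Int.add_ediv_of_dvd_left (hα.norm_dvd hG x)]
  map_smul' c x := by
    rw [bform_smul_left, mul_left_comm, Int.mul_ediv_assoc _ (hα.norm_dvd hG x)]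
    rfl

theorem IsRoot.coroot_mul_norm (hG : G.IsSymm) {α : Fin n → ℤ} (hα : IsRoot G α)
    (x : Fin n → ℤ) : hα.coroot hG x * bform G α α = 2 * bform G x α :=
  Int.ediv_mul_cancel (hα.norm_dvd hG x)

theorem IsRoot.coroot_self (hG : G.IsSymm) {α : Fin n → ℤ} (hα : IsRoot G α) :
    hα.coroot hG α = 2 :=
  mul_right_cancel₀ hα.norm_ne_zero (hα.coroot_mul_norm hG α)

/-- The reflection in a root lies in `Wr`. -/
theorem IsRoot.exists_mem_Wr (hG : G.IsSymm) {α : Fin n → ℤ} (hα : IsRoot G α) :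
    ∃ w ∈ Wr n G, ∀ x, w • x = x - hα.coroot hG x • α := by
  let f := Module.reflection (hα.coroot_self hG)
  have hf (x) : f x = x - hα.coroot hG x • α := Module.reflection_apply ..
  have hmem : f ∈ OrthGroup n G := by
    intro x y
    have hx := hα.coroot_mul_norm hG x
    have hy := hα.coroot_mul_norm hG y
    rw [hf, hf, bform_sub_left, bform_smul_left, bform_comm hG x, bform_comm hG α,
      bform_sub_left, bform_sub_left, bform_smul_left, bform_smul_left, bform_comm hG y x,
      bform_comm hG α x]
    refine mul_left_cancel₀ two_ne_zero ?_
    linear_combination hα.coroot hG y * hx + hα.coroot hG x * hy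
  exact ⟨⟨f, hmem⟩, Subgroup.subset_closure ⟨α, hα, hf⟩, hf⟩

theorem bform_smul_smul (g : OrthGroup n G) (x y : Fin n → ℤ) :
    bform G (g • x) (g • y) = bform G x y :=
  g.2 x y

/-- A subgroup `H` has finite index as soon as it moves each point of an orbit with finite
stabilizers into a fixed finite set. -/
theorem Subgroup.finiteIndex_of_orbit {Γ X : Type*} [Group Γ] [MulAction Γ X] (H : Subgroup Γ)
    {v : X} (hv : (MulAction.stabilizer Γ v : Set Γ).Finite) {T : Set X} (hT : T.Finite)
    (h : ∀ g : Γ, ∃ w ∈ H, w • g • v ∈ T) : H.FiniteIndex := by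
  have hK : ((fun g : Γ => g • v) ⁻¹' T).Finite := by
    refine hT.preimage' fun t _ => ?_
    rcases ((fun g : Γ => g • v) ⁻¹' {t}).eq_empty_or_nonempty with he | ⟨g, hg⟩
    · rw [he]; exact Set.finite_empty
    · refine (hv.image (g * ·)).subset fun k hk => ⟨g⁻¹ * k, ?_, mul_inv_cancel_left g k⟩
      have hk : k • v = t := hk
      have hg : g • v = t := hg
      rw [SetLike.mem_coe, MulAction.mem_stabilizer_iff, mul_smul, hk, ← hg, inv_smul_smul]
  have := hK.to_subtype
  have hsurj : Function.Surjective fun k : (fun g : Γ => g • v) ⁻¹' T =>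
      (((k : Γ)⁻¹ : Γ) : Γ ⧸ H) := by
    intro q
    induction q using QuotientGroup.induction_on with
    | H g =>
      obtain ⟨w, hw, hwT⟩ := h g⁻¹
      refine ⟨⟨w * g⁻¹, by rwa [Set.mem_preimage, mul_smul]⟩, ?_⟩
      exact QuotientGroup.eq.2 (by simpa using hw)
  have := Finite.of_surjective _ hsurj
  exact Subgroup.finiteIndex_of_finite_quotient

end General

/-- Matrix of an embedding of `U ⊕ D₄ ⊕ A₁⁷` into a diagonal lattice. -/
def frameMatrix : Matrix (Fin 13) (Fin 13) ℤ :=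
  !![1, 1, 1, -1, 0, 0, 1, 0, 0, 0, 0, 0, 0;
    0, 0, 0, 0, 0, 0, 0, 1, 0, 0, 0, 0, 0;
    0, 0, 0, 0, 0, 0, 0, 0, 1, 0, 0, 0, 0;
    0, 0, 0, 0, 0, 0, 0, 0, 0, 1, 0, 0, 0;
    0, 0, 0, 0, 0, 0, 0, 0, 0, 0, 1, 0, 0;
    0, 0, 0, 0, 0, 0, 0, 0, 0, 0, 0, 1, 0;
    0, 0, 0, 0, 0, 0, 0, 0, 0, 0, 0, 0, 1;
    1, 1, 1, -1, 0, 0, 2, 0, 0, 0, 0, 0, 0;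
    1, 0, 1, -1, 0, 0, 0, 0, 0, 0, 0, 0, 0;
    0, 1, 1, -1, 0, 0, 0, 0, 0, 0, 0, 0, 0;
    0, 0, 1, 1, -1, 0, 0, 0, 0, 0, 0, 0, 0;
    0, 0, 0, 0, 1, -1, 0, 0, 0, 0, 0, 0, 0;
    0, 0, 0, 0, 0, 1, 0, 0, 0, 0, 0, 0, 0]

/-- Diagonal entries of the form on the diagonal lattice. -/
def frameWeight : Fin 13 → ℤ := ![2, -2, -2, -2, -2, -2, -2, -1, -1, -1, -1, -1, -1]

/-- The diagonal form of signature `(1, 12)` in which `U ⊕ D₄ ⊕ A₁⁷` embeds. -/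
def lorentz (u v : Fin 13 → ℤ) : ℤ := ∑ i, frameWeight i * u i * v i

/-- The simple roots of a fundamental chamber of the reflection group. -/
def simpleRoot : Fin 19 → Fin 13 → ℤ :=
  ![![0, 0, 0, 0, 0, 0, 0, -1, 1, 0, 0, 0, 0],
    ![0, 0, 0, 0, 0, 0, 0, 0, -1, 1, 0, 0, 0],
    ![0, 0, 0, 0, 0, 0, 0, 0, 0, -1, 1, 0, 0],
    ![0, 0, 0, 0, 0, 0, 0, 0, 0, 0, -1, 1, 0],
    ![0, 0, 0, 0, 0, 0, 0, 0, 0, 0, 0, -1, 1],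
    ![0, 0, 0, 0, 0, 0, 0, 0, 0, 0, 0, 0, -1],
    ![1, 0, 0, 0, 0, 0, -1, 0, 0, 0, 0, 0, 0],
    ![-1, 1, 0, 0, 0, 0, 0, 0, 0, 0, 0, 0, 0],
    ![1, 0, 0, 1, 0, 0, 0, 0, 0, 0, 0, 0, 0],
    ![0, 0, 0, 0, 1, 0, 0, 0, 0, 0, 0, 0, 0],
    ![0, 0, 0, 0, 0, 1, 0, 0, 0, 0, 0, 0, 0],
    ![0, 0, -1, -1, -2, -2, 0, 0, 0, 0, 0, 0, 0],
    ![2, 2, -1, 1, 0, 0, -1, 1, 1, 1, 0, 0, 0],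
    ![0, 0, 0, 0, 0, 0, 1, 1, 0, 0, 0, 0, 0],
    ![0, 0, 2, 1, 2, 1, 0, 0, 0, 0, 0, 0, 0],
    ![2, 2, 0, 0, 0, 0, -1, 1, 1, 1, 1, 1, 0],
    ![4, 2, -1, 1, 0, 0, -1, 1, 1, 1, 1, 1, 1],
    ![3, 3, 0, 2, 1, 0, -1, 1, 1, 1, 1, 1, 1],
    ![4, 4, 0, 2, 0, 0, -2, 2, 1, 1, 1, 1, 1]]

/-- The simple roots in the diagonal frame. -/
def frameRoot : Fin 19 → Fin 13 → ℤ :=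
  ![![0, -1, 1, 0, 0, 0, 0, 0, 0, 0, 0, 0, 0],
    ![0, 0, -1, 1, 0, 0, 0, 0, 0, 0, 0, 0, 0],
    ![0, 0, 0, -1, 1, 0, 0, 0, 0, 0, 0, 0, 0],
    ![0, 0, 0, 0, -1, 1, 0, 0, 0, 0, 0, 0, 0],
    ![0, 0, 0, 0, 0, -1, 1, 0, 0, 0, 0, 0, 0],
    ![0, 0, 0, 0, 0, 0, -1, 0, 0, 0, 0, 0, 0],
    ![0, 0, 0, 0, 0, 0, 0, -1, 1, 0, 0, 0, 0],
    ![0, 0, 0, 0, 0, 0, 0, 0, -1, 1, 0, 0, 0],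
    ![0, 0, 0, 0, 0, 0, 0, 0, 0, -1, 1, 0, 0],
    ![0, 0, 0, 0, 0, 0, 0, 0, 0, 0, -1, 1, 0],
    ![0, 0, 0, 0, 0, 0, 0, 0, 0, 0, 0, -1, 1],
    ![0, 0, 0, 0, 0, 0, 0, 0, 0, 0, 0, 0, -2],
    ![1, 1, 1, 1, 0, 0, 0, 0, 0, 0, 0, 0, 0],
    ![1, 1, 0, 0, 0, 0, 0, 2, 0, 0, 0, 0, 0],
    ![1, 0, 0, 0, 0, 0, 0, 1, 1, 1, 1, 1, 1],
    ![3, 1, 1, 1, 1, 1, 0, 2, 2, 2, 0, 0, 0],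
    ![3, 1, 1, 1, 1, 1, 1, 2, 2, 0, 0, 0, 0],
    ![3, 1, 1, 1, 1, 1, 1, 2, 1, 1, 1, 1, 0],
    ![4, 2, 1, 1, 1, 1, 1, 2, 2, 2, 2, 0, 0]]

/-- Isotropic generators of the rays at infinity of the fundamental chamber, in the diagonal
frame. -/
def frameCusp : Fin 22 → Fin 13 → ℤ :=
  ![![1, 1, 0, 0, 0, 0, 0, 0, 0, 0, 0, 0, 0],
    ![2, 1, 1, 0, 0, 0, 0, 1, 1, 1, 1, 0, 0],
    ![3, 1, 1, 1, 0, 0, 0, 2, 2, 2, 0, 0, 0],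
    ![3, 1, 1, 1, 1, 1, 0, 2, 2, 0, 0, 0, 0],
    ![1, 0, 0, 0, 0, 0, 0, 1, 1, 0, 0, 0, 0],
    ![4, 2, 1, 1, 1, 1, 0, 2, 2, 2, 2, 0, 0],
    ![3, 1, 1, 1, 1, 1, 1, 1, 1, 1, 1, 1, 1],
    ![3, 1, 1, 1, 1, 0, 0, 2, 2, 1, 1, 0, 0],
    ![3, 1, 1, 1, 1, 1, 0, 2, 1, 1, 1, 1, 0],
    ![5, 2, 2, 1, 1, 1, 1, 3, 3, 2, 2, 0, 0],
    ![3, 1, 1, 1, 1, 1, 1, 2, 1, 1, 0, 0, 0],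
    ![4, 1, 1, 1, 1, 1, 1, 3, 3, 1, 1, 0, 0],
    ![4, 2, 1, 1, 1, 1, 1, 2, 2, 2, 1, 1, 0],
    ![6, 2, 2, 2, 2, 1, 1, 3, 3, 3, 3, 0, 0],
    ![9, 3, 3, 3, 2, 2, 2, 6, 4, 4, 4, 0, 0],
    ![9, 3, 3, 3, 2, 2, 2, 6, 6, 2, 2, 2, 0],
    ![6, 2, 2, 2, 2, 1, 1, 4, 4, 1, 1, 1, 1],
    ![7, 3, 2, 2, 2, 2, 2, 4, 4, 2, 2, 0, 0],
    ![8, 3, 3, 2, 2, 2, 2, 5, 5, 2, 2, 1, 1],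
    ![10, 4, 3, 3, 3, 3, 2, 6, 6, 2, 2, 2, 2],
    ![9, 3, 3, 3, 3, 3, 2, 4, 4, 4, 4, 0, 0],
    ![7, 2, 2, 2, 2, 2, 2, 4, 4, 3, 3, 0, 0]]

/-- A vector of norm `2` in the lattice, spanning the positive axis of the diagonal frame. -/
def axis : Fin 13 → ℤ := ![2, 2, -1, 1, 0, 0, -1, 0, 0, 0, 0, 0, 0]

/-- An interior vector of the fundamental chamber. -/
def chamberVector : Fin 13 → ℤ := ![28, 25, -6, 13, 3, 1, -12, 8, 7, 6, 5, 2, 1]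

/-- `gramS`, with its index set in normal form. -/
abbrev gram13 : Matrix (Fin 13) (Fin 13) ℤ := gramS

theorem gram13_eq : gram13 = frameMatrixᵀ * diagonal frameWeight * frameMatrix := by
  decide +kernel

theorem gram13_isSymm : gram13.IsSymm := by
  unfold Matrix.IsSymm
  decide +kernel

theorem frameMatrix_mulVec_simpleRoot : ∀ i, frameMatrix *ᵥ simpleRoot i = frameRoot i := by
  decide +kernel

theorem isRoot_simpleRoot (i : Fin 19) : IsRoot gram13 (simpleRoot i) := by
  have h : ∀ i, bform gram13 (simpleRoot i) (simpleRoot i) = -2 ∨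
      bform gram13 (simpleRoot i) (simpleRoot i) = -4 ∧
        ∀ j, (2 : ℤ) ∣ (simpleRoot i ᵥ* gram13) j := by
    decide +kernel
  exact (h i).imp_right fun h => (isRoot_of_norm_eq_neg_four h.1 h.2).resolve_left (by simp [h.1])

theorem bform_chamberVector_pos :
    ∀ i, 0 < bform gram13 (simpleRoot i) chamberVector := by
  decide +kernel

theorem bform_gram13 (x y : Fin 13 → ℤ) :
    bform gram13 x y = lorentz (frameMatrix *ᵥ x) (frameMatrix *ᵥ y) := by
  rw [bform, gram13_eq, ← mulVec_mulVec, ← mulVec_mulVec, dotProduct_mulVec, vecMul_transpose,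
    lorentz]
  simp only [dotProduct, mulVec_diagonal]
  exact Finset.sum_congr rfl fun i _ => by ring

theorem frameMatrix_mulVec_injective : Function.Injective (frameMatrix *ᵥ ·) := by
  intro x y h
  have h (i) := congrFun h i
  simp [frameMatrix, mulVec, dotProduct, Fin.sum_univ_succ, Fin.forall_fin_succ] at h
  ext i
  fin_cases i <;> simp <;> omega

theorem frameMatrix_mulVec_axis : frameMatrix *ᵥ axis = Pi.single 0 1 := by
  decide +kernel

theorem frameWeight_succ_le (i : Fin 12) : frameWeight i.succ ≤ -1 := by
  revert i
  decide

theorem lorentz_self (u : Fin 13 → ℤ) :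
    lorentz u u = 2 * u 0 ^ 2 + ∑ i : Fin 12, frameWeight i.succ * u i.succ ^ 2 := by
  rw [lorentz, Fin.sum_univ_succ]
  simp only [mul_assoc, ← sq]
  rfl

theorem lorentz_self_add_sq_le (u : Fin 13 → ℤ) (i : Fin 12) :
    lorentz u u + u i.succ ^ 2 ≤ 2 * u 0 ^ 2 := by
  have h : ∀ j ∈ Finset.univ, 0 ≤ -(frameWeight (Fin.succ j) * u j.succ ^ 2) := fun j _ => by
    nlinarith [frameWeight_succ_le j, sq_nonneg (u j.succ)]
  have := Finset.single_le_sum h (Finset.mem_univ i)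
  rw [Finset.sum_neg_distrib] at this
  nlinarith [lorentz_self u, frameWeight_succ_le i, sq_nonneg (u i.succ)]

theorem lorentz_self_le (u : Fin 13 → ℤ) : lorentz u u ≤ 2 * u 0 ^ 2 :=
  (le_add_of_nonneg_right (sq_nonneg _)).trans (lorentz_self_add_sq_le u 0)

/-- Two vectors in the same half of the light cone have positive product. -/
theorem lorentz_pos {u v : Fin 13 → ℤ} (hu : 0 < lorentz u u) (hv : 0 ≤ lorentz v v)
    (hu0 : 0 < u 0) (hv0 : 0 < v 0) : 0 < lorentz u v := by
  have h := lorentz_self_le (v 0 • u - u 0 • v)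
  have h' : lorentz (v 0 • u - u 0 • v) (v 0 • u - u 0 • v) =
      v 0 ^ 2 * lorentz u u - 2 * (u 0 * v 0) * lorentz u v + u 0 ^ 2 * lorentz v v := by
    simp only [lorentz, Finset.mul_sum, ← Finset.sum_sub_distrib, ← Finset.sum_add_distrib]
    refine Finset.sum_congr rfl fun i _ => ?_
    simp only [Pi.sub_apply, Pi.smul_apply, smul_eq_mul]
    ring
  simp only [h', Pi.sub_apply, Pi.smul_apply, smul_eq_mul, mul_comm (v 0), sub_self] at h
  have h1 : 0 < v 0 ^ 2 * lorentz u u := by positivity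
  have h2 : 0 ≤ u 0 ^ 2 * lorentz v v := by positivity
  refine pos_of_mul_pos_right (a := 2 * (u 0 * v 0)) ?_ (by positivity)
  linarith

theorem finite_setOf_bform_self_eq (K b : ℤ) :
    {x : Fin 13 → ℤ | |(frameMatrix *ᵥ x) 0| ≤ K ∧ bform gram13 x x = b}.Finite := by
  let M := 2 * K ^ 2 + |b| + K
  refine ((Set.finite_Icc (fun _ => -M) fun _ => M).preimage
    frameMatrix_mulVec_injective.injOn).subset fun x ⟨hK, hb⟩ => ?_
  have h (i) : |(frameMatrix *ᵥ x) i| ≤ M := by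
    set u := frameMatrix *ᵥ x
    have hK0 : 0 ≤ K := (abs_nonneg _).trans hK
    refine Fin.cases ?_ (fun j => ?_) i
    · have := sq_nonneg K
      have := abs_nonneg b
      omega
    · have h1 := lorentz_self_add_sq_le u j
      rw [← bform_gram13, hb] at h1
      have h2 : u 0 ^ 2 ≤ K ^ 2 := sq_le_sq' (abs_le.1 hK).1 (abs_le.1 hK).2
      have h3 : |u j.succ| ≤ u j.succ ^ 2 := by
        rw [← sq_abs]
        exact Int.le_self_sq _
      have := neg_abs_le b
      omega
  exact ⟨fun i => (abs_le.1 (h i)).1, fun i => (abs_le.1 (h i)).2⟩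

theorem bform_axis (x : Fin 13 → ℤ) : bform gram13 x axis = 2 * (frameMatrix *ᵥ x) 0 := by
  rw [bform_gram13, frameMatrix_mulVec_axis, lorentz, Finset.sum_eq_single 0]
  · simp [frameWeight]
  · intro i _ hi
    simp [hi]
  · simp

theorem finite_stabilizer_axis :
    (MulAction.stabilizer (OrthGroup 13 gram13) axis : Set (OrthGroup 13 gram13)).Finite := by
  have hT := Set.Finite.pi' fun i : Fin 13 => finite_setOf_bform_self_eq
    |(frameMatrix *ᵥ Pi.single i 1) 0| (bform gram13 (Pi.single i 1) (Pi.single i 1))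
  refine Set.Finite.of_injOn (f := fun g i => g • (Pi.single i 1 : Fin 13 → ℤ)) ?_ ?_ hT
  · intro g hg i
    have hg : g • axis = axis := hg
    refine ⟨?_, bform_smul_smul g _ _⟩
    have := bform_smul_smul g (Pi.single i 1) axis
    rw [hg, bform_axis, bform_axis] at this
    rw [mul_left_cancel₀ two_ne_zero this]
  · intro g _ g' _ h
    refine Subtype.ext (LinearEquiv.toLinearMap_injective (LinearMap.pi_ext' fun i => ?_))
    exact LinearMap.ext_ring (congrFun h i)

theorem frameMatrix_mulVec_zero_pos {x y : Fin 13 → ℤ} (hx : 0 < bform gram13 x x)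
    (hy : 0 < bform gram13 y y) (hx0 : 0 < (frameMatrix *ᵥ x) 0) (hxy : 0 < bform gram13 x y) :
    0 < (frameMatrix *ᵥ y) 0 := by
  rw [bform_gram13] at *
  by_contra! h
  rcases h.eq_or_lt with h | h
  · have := lorentz_self_le (frameMatrix *ᵥ y)
    rw [h] at this
    linarith
  · have hneg : lorentz (frameMatrix *ᵥ x) (-(frameMatrix *ᵥ y)) =
        -lorentz (frameMatrix *ᵥ x) (frameMatrix *ᵥ y) := by
      simp [lorentz]
    have := lorentz_pos (v := -(frameMatrix *ᵥ y)) hx (by simpa [lorentz] using hy.le) hx0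
      (by simpa using h)
    linarith

/-- Every positive vector of norm `2` is carried into the fundamental chamber by `Wr`. -/
theorem exists_mem_Wr_chamber {x : Fin 13 → ℤ} (hx : bform gram13 x x = 2)
    (h0 : 0 < (frameMatrix *ᵥ x) 0) :
    ∃ w ∈ Wr 13 gram13, 0 < (frameMatrix *ᵥ (w • x)) 0 ∧
      ∀ i, 0 ≤ bform gram13 (w • x) (simpleRoot i) := by
  have hpos {x : Fin 13 → ℤ} (hx : bform gram13 x x = 2) (h0 : 0 < (frameMatrix *ᵥ x) 0) :
      0 < bform gram13 x chamberVector := by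
    rw [bform_gram13] at *
    refine lorentz_pos (by omega) ?_ h0 ?_ <;> decide +kernel
  induction hm : (bform gram13 x chamberVector).toNat
    using Nat.strong_induction_on generalizing x with
  | _ m ih =>
    by_cases hc : ∀ i, 0 ≤ bform gram13 x (simpleRoot i)
    · exact ⟨1, one_mem _, by simpa using h0, by simpa using hc⟩
    · push Not at hc
      obtain ⟨i, hi⟩ := hc
      have hr := isRoot_simpleRoot i
      obtain ⟨s, hs, hsx⟩ := hr.exists_mem_Wr gram13_isSymm
      have hq : 0 < hr.coroot gram13_isSymm x := by
        have := hr.coroot_mul_norm gram13_isSymm x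
        have := hr.norm_neg
        by_contra! h
        nlinarith
      have hx' : bform gram13 (s • x) (s • x) = 2 := (bform_smul_smul s x x).trans hx
      have h0' : 0 < (frameMatrix *ᵥ (s • x)) 0 := by
        refine frameMatrix_mulVec_zero_pos (by omega) (by omega) h0 ?_
        rw [bform_comm gram13_isSymm, hsx, bform_sub_left, bform_smul_left,
          bform_comm gram13_isSymm (simpleRoot i), hx]
        nlinarith
      have hlt : bform gram13 (s • x) chamberVector < bform gram13 x chamberVector := by
        rw [hsx, bform_sub_left, bform_smul_left]
        nlinarith [bform_chamberVector_pos i]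
      have := hpos hx' h0'
      obtain ⟨w, hw, hwx⟩ := ih _ (by omega) hx' h0' rfl
      exact ⟨w * s, mul_mem hw hs, by rwa [mul_smul]⟩

set_option maxHeartbeats 4000000 in
/-- The quadratic inequality bounding the height in the fundamental chamber, proved by nonnegative
combinations of products of the defining linear forms on each piece of a subdivision. -/
theorem height_le {a u1 u2 u3 u4 u5 u6 v1 v2 v3 v4 v5 v6 : ℚ}
    (q : 2 * a ^ 2 - 2 * (u1 ^ 2 + u2 ^ 2 + u3 ^ 2 + u4 ^ 2 + u5 ^ 2 + u6 ^ 2) -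
      (v1 ^ 2 + v2 ^ 2 + v3 ^ 2 + v4 ^ 2 + v5 ^ 2 + v6 ^ 2) = 2)
    (l0 : 0 ≤ u1 - u2)
    (l1 : 0 ≤ u2 - u3)
    (l2 : 0 ≤ u3 - u4)
    (l3 : 0 ≤ u4 - u5)
    (l4 : 0 ≤ u5 - u6)
    (l5 : 0 ≤ u6)
    (l6 : 0 ≤ v1 - v2)
    (l7 : 0 ≤ v2 - v3)
    (l8 : 0 ≤ v3 - v4)
    (l9 : 0 ≤ v4 - v5)
    (l10 : 0 ≤ v5 - v6)
    (l11 : 0 ≤ v6)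
    (l12 : 0 ≤ a - u1 - u2 - u3)
    (l13 : 0 ≤ a - u1 - v1)
    (l14 : 0 ≤ 2 * a - v1 - v2 - v3 - v4 - v5 - v6)
    (l15 : 0 ≤ 3 * a - u1 - u2 - u3 - u4 - u5 - v1 - v2 - v3)
    (l16 : 0 ≤ 3 * a - u1 - u2 - u3 - u4 - u5 - u6 - v1 - v2)
    (l17 : 0 ≤ 6 * a - 2 * u1 - 2 * u2 - 2 * u3 - 2 * u4 - 2 * u5 - 2 * u6 - 2 * v1 - v2 - v3 -
      v4 - v5)
    (l18 : 0 ≤ 4 * a - 2 * u1 - u2 - u3 - u4 - u5 - u6 - v1 - v2 - v3 - v4)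
    (c0 : 0 ≤ 2 * a - 2 * u1 - 1)
    (c1 : 0 ≤ 4 * a - 2 * u1 - 2 * u2 - v1 - v2 - v3 - v4 - 1)
    (c2 : 0 ≤ 6 * a - 2 * u1 - 2 * u2 - 2 * u3 - 2 * v1 - 2 * v2 - 2 * v3 - 1)
    (c3 : 0 ≤ 6 * a - 2 * u1 - 2 * u2 - 2 * u3 - 2 * u4 - 2 * u5 - 2 * v1 - 2 * v2 - 1)
    (c4 : 0 ≤ 2 * a - v1 - v2 - 1)
    (c5 : 0 ≤ 8 * a - 4 * u1 - 2 * u2 - 2 * u3 - 2 * u4 - 2 * u5 - 2 * v1 - 2 * v2 - 2 * v3 -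
      2 * v4 - 1)
    (c6 : 0 ≤ 6 * a - 2 * u1 - 2 * u2 - 2 * u3 - 2 * u4 - 2 * u5 - 2 * u6 - v1 - v2 - v3 - v4 -
      v5 - v6 - 1)
    (c7 : 0 ≤ 6 * a - 2 * u1 - 2 * u2 - 2 * u3 - 2 * u4 - 2 * v1 - 2 * v2 - v3 - v4 - 1)
    (c8 : 0 ≤ 6 * a - 2 * u1 - 2 * u2 - 2 * u3 - 2 * u4 - 2 * u5 - 2 * v1 - v2 - v3 - v4 - v5 - 1)
    (c9 : 0 ≤ 10 * a - 4 * u1 - 4 * u2 - 2 * u3 - 2 * u4 - 2 * u5 - 2 * u6 - 3 * v1 - 3 * v2 -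
      2 * v3 - 2 * v4 - 1)
    (c10 : 0 ≤ 6 * a - 2 * u1 - 2 * u2 - 2 * u3 - 2 * u4 - 2 * u5 - 2 * u6 - 2 * v1 - v2 - v3 - 1)
    (c11 : 0 ≤ 8 * a - 2 * u1 - 2 * u2 - 2 * u3 - 2 * u4 - 2 * u5 - 2 * u6 - 3 * v1 - 3 * v2 -
      v3 - v4 - 1)
    (c12 : 0 ≤ 8 * a - 4 * u1 - 2 * u2 - 2 * u3 - 2 * u4 - 2 * u5 - 2 * u6 - 2 * v1 - 2 * v2 -
      2 * v3 - v4 - v5 - 1)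
    (c13 : 0 ≤ 12 * a - 4 * u1 - 4 * u2 - 4 * u3 - 4 * u4 - 2 * u5 - 2 * u6 - 3 * v1 - 3 * v2 -
      3 * v3 - 3 * v4 - 1)
    (c14 : 0 ≤ 18 * a - 6 * u1 - 6 * u2 - 6 * u3 - 4 * u4 - 4 * u5 - 4 * u6 - 6 * v1 - 4 * v2 -
      4 * v3 - 4 * v4 - 1)
    (c15 : 0 ≤ 18 * a - 6 * u1 - 6 * u2 - 6 * u3 - 4 * u4 - 4 * u5 - 4 * u6 - 6 * v1 - 6 * v2 -
      2 * v3 - 2 * v4 - 2 * v5 - 1)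
    (c16 : 0 ≤ 12 * a - 4 * u1 - 4 * u2 - 4 * u3 - 4 * u4 - 2 * u5 - 2 * u6 - 4 * v1 - 4 * v2 -
      v3 - v4 - v5 - v6 - 1)
    (c17 : 0 ≤ 14 * a - 6 * u1 - 4 * u2 - 4 * u3 - 4 * u4 - 4 * u5 - 4 * u6 - 4 * v1 - 4 * v2 -
      2 * v3 - 2 * v4 - 1)
    (c18 : 0 ≤ 16 * a - 6 * u1 - 6 * u2 - 4 * u3 - 4 * u4 - 4 * u5 - 4 * u6 - 5 * v1 - 5 * v2 -
      2 * v3 - 2 * v4 - v5 - v6 - 1)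
    (c19 : 0 ≤ 20 * a - 8 * u1 - 6 * u2 - 6 * u3 - 6 * u4 - 6 * u5 - 4 * u6 - 6 * v1 - 6 * v2 -
      2 * v3 - 2 * v4 - 2 * v5 - 2 * v6 - 1)
    (c20 : 0 ≤ 18 * a - 6 * u1 - 6 * u2 - 6 * u3 - 6 * u4 - 6 * u5 - 4 * u6 - 4 * v1 - 4 * v2 -
      4 * v3 - 4 * v4 - 1)
    (c21 : 0 ≤ 14 * a - 4 * u1 - 4 * u2 - 4 * u3 - 4 * u4 - 4 * u5 - 4 * u6 - 4 * v1 - 4 * v2 -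
      3 * v3 - 3 * v4 - 1) :
    a ≤ 200 := by
  rcases le_total 0 (6 * a - 2 * u1 - 2 * u2 - 2 * u3 - 2 * u4 - 2 * u5 - 5 * u6 - 2 * v1 - v2 -
    v3 - v4 - v5) with t0 | t0
  · rcases le_total 0 (4 * a - 2 * u1 - u2 - u3 - 2 * u4 - 2 * u5 - 2 * u6 - v1 - v2 -
    v4) with t1 | t1
    · rcases le_total 0 (2 * a - 2 * u3 - 2 * u4 - v1 - v2) with t2 | t2
      · linear_combination 100 * q + 44 / 3 * mul_nonneg l2 l9 + 67 / 3 * mul_nonneg l5 l14 +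
          200 * mul_nonneg l0 l13 + 37 * mul_nonneg l5 t1 + 179 / 18 * mul_nonneg l3 l6 +
          6 * mul_nonneg l8 l11 + 73 * mul_nonneg l3 l4 + 56 / 3 * mul_nonneg l1 l14 +
          30 * mul_nonneg l1 l11 + 421 / 6 * l2 + 11 / 6 * mul_nonneg l10 c5 +
          100 * mul_nonneg l9 l14 + 44 / 3 * mul_nonneg l2 l12 + 27 * mul_nonneg l1 l7 +
          2 * mul_nonneg l1 c1 + 34 / 3 * mul_nonneg l1 l10 + 56 * mul_nonneg l6 l8 +
          278 / 3 * mul_nonneg l10 l11 + 37 * mul_nonneg l2 l13 + 442 / 9 * mul_nonneg l2 l3 +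
          322 / 3 * mul_nonneg l9 l10 + 689 / 12 * l3 + 11 / 3 * mul_nonneg l3 l10 +
          30 * mul_nonneg l2 l4 + 19 / 6 * l14 + 15 * mul_nonneg l8 l10 + 144 * mul_nonneg l0 l1 +
          43 * mul_nonneg l4 l7 + 83 * mul_nonneg l7 l13 + 216 * mul_nonneg l1 l6 +
          11 / 6 * mul_nonneg l10 c2 + 39 / 2 * l7 + 96 * mul_nonneg l4 l15 +
            83 * mul_nonneg l0 l7 +
          727 / 18 * mul_nonneg l3 c1 + 200 * mul_nonneg l9 l11 + 67 * mul_nonneg l5 l11 +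
          288 * mul_nonneg l1 l13 + 37 / 2 * mul_nonneg l7 c4 + 2 * l13 +
          272 / 3 * mul_nonneg l12 l14 + 278 / 3 * mul_nonneg l10 l14 +
            637 / 18 * mul_nonneg l3 l15 +
          2 * mul_nonneg l12 c4 + 2 * mul_nonneg l8 l14 + 56 / 9 * mul_nonneg l3 c0 +
          3 * mul_nonneg l5 c14 + 10 * l11 + 28 * mul_nonneg l7 l8 + 2 * mul_nonneg l8 l9 +
          44 * mul_nonneg l4 t1 + 196 * mul_nonneg l9 l12 + 1 / 2 * l8 + 15 * mul_nonneg l5 l18 +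
          4 * mul_nonneg l4 c5 + 1439 / 18 * mul_nonneg l3 t2 + 100 * mul_nonneg l11 l14 +
          52 * mul_nonneg l1 l12 + 20 / 9 * mul_nonneg l3 l12 + 11 * mul_nonneg l10 l13 +
          11 * mul_nonneg l7 l10 + 83 / 2 * mul_nonneg l6 l7 + 44 / 3 * mul_nonneg l3 l9 +
          mul_nonneg l5 c9 + 40 * mul_nonneg l7 t2 + 70 * mul_nonneg l8 l15 +
          953 / 18 * mul_nonneg l3 l7 + 56 * mul_nonneg l0 l8 + 179 / 18 * mul_nonneg l3 l13 +
          11 * mul_nonneg l11 c0 + 37 * mul_nonneg l5 t0 + 11 / 3 * mul_nonneg l14 c0 +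
          30 * mul_nonneg l4 t2 + 370 * mul_nonneg l11 l12 + 37 * mul_nonneg l2 t2 + 19 / 6 * l10 +
          52 * mul_nonneg l5 l10 + 22 / 3 * mul_nonneg l4 l14 + 11 * mul_nonneg l6 l10 +
          15 * mul_nonneg l1 l2 + 533 / 36 * mul_nonneg l3 c5 + 37 * mul_nonneg l2 l6 +
          16 * mul_nonneg l5 t2 + 3 / 2 * l6 + 66 * mul_nonneg l4 l8 + 272 * mul_nonneg l10 l12 +
          445 / 6 * mul_nonneg l2 c2 + 100 * mul_nonneg l6 l13 + 200 * mul_nonneg l0 l6 +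
          84 * mul_nonneg l8 l13
      · rw [← neg_nonneg] at t2
        rcases le_total 0 (-4 * a + 2 * u1 + 2 * u2 + 2 * u3 + 2 * v1 + 2 * v2 - v3 - v4 +
          2 * v5) with t3 | t3
        · linear_combination 100 * q + 1179 / 100 * mul_nonneg l5 l11 +
            4323 / 100 * mul_nonneg l0 l1 + 16941 / 400 * mul_nonneg l6 c8 +
            1173 / 40 * mul_nonneg l8 t3 + 664 / 25 * mul_nonneg l4 l15 +
            1881 / 100 * mul_nonneg l1 c1 + 1801 / 50 * mul_nonneg l2 l11 +
            956 / 25 * mul_nonneg l5 t0 + 1826 / 25 * mul_nonneg l4 t1 + 92 / 5 * l16 +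
            1401 / 200 * mul_nonneg l3 l14 + 1069 / 400 * mul_nonneg l1 l6 +
            1911 / 400 * mul_nonneg l3 l6 + 562 / 5 * mul_nonneg l3 l12 +
            23057 / 200 * mul_nonneg l11 l12 + 651 / 50 * mul_nonneg l13 l17 +
            51 / 25 * mul_nonneg t1 t3 + 5681 / 200 * mul_nonneg l12 l14 +
            33049 / 800 * mul_nonneg l6 l7 + 112 / 5 * mul_nonneg l12 c4 +
            6193 / 100 * mul_nonneg l1 t2 + 2851 / 100 * mul_nonneg l0 c5 +
            1826 / 25 * mul_nonneg l8 l15 + 5113 / 400 * mul_nonneg l5 l6 +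
            813 / 50 * mul_nonneg l0 l13 + 3 * l15 + 137 / 80 * mul_nonneg l1 c20 +
            57 / 2 * mul_nonneg l0 l2 + 1428 / 25 * mul_nonneg l8 l11 +
            1327 / 100 * mul_nonneg l6 l8 + 307 / 10 * mul_nonneg l0 t2 +
            1911 / 200 * mul_nonneg l13 t2 + 100 * mul_nonneg l11 l14 + 64 / 25 * mul_nonneg l5 l8 +
            3088 / 25 * mul_nonneg l2 l12 + 2582 / 25 * mul_nonneg l2 l3 +
            3647 / 200 * mul_nonneg l2 l14 + 7181 / 400 * l6 + 664 / 25 * mul_nonneg l3 l15 +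
            111 / 100 * mul_nonneg l0 c0 + 107 / 5 * mul_nonneg l3 c7 +
              1034 / 25 * mul_nonneg l4 l9 +
            427 / 40 * mul_nonneg l9 t3 + 413 / 100 * mul_nonneg l1 l2 +
            2361 / 25 * mul_nonneg l10 l12 + 111 / 100 * mul_nonneg l0 l14 +
            6449 / 200 * mul_nonneg l13 t3 + 9459 / 200 * mul_nonneg l9 l10 +
            3611 / 200 * mul_nonneg l1 c9 + 111 / 200 * mul_nonneg l13 c6 +
            1676 / 25 * mul_nonneg l5 l16 + 1683 / 200 * mul_nonneg l11 t1 +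
            603 / 20 * mul_nonneg l8 l14 + 2196 / 25 * mul_nonneg l4 l5 +
            1179 / 200 * mul_nonneg l10 l15 + 1949 / 25 * mul_nonneg l1 l15 +
            1643 / 100 * mul_nonneg l8 l13 + 189 / 25 * mul_nonneg l1 l10 +
            63 / 25 * mul_nonneg l14 t1 + 572 / 5 * mul_nonneg l9 l15 +
            30389 / 400 * mul_nonneg l13 c8 + 346 / 5 * mul_nonneg l9 l14 +
            2869 / 400 * mul_nonneg l13 c20 + 1289 / 50 * l0 + 2104 / 25 * mul_nonneg l8 l9 +
            2303 / 100 * mul_nonneg l0 l6 + 12317 / 160 * mul_nonneg l6 l13 +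
            6503 / 200 * mul_nonneg l15 t3 + 792 / 25 * mul_nonneg l9 l12 + 349 / 10 * l13 +
            89 * mul_nonneg l1 l12 + 1379 / 200 * mul_nonneg l2 t3 + 3 / 2 * mul_nonneg t3 c3 +
            6573 / 200 * mul_nonneg l8 l10 + 214 / 5 * mul_nonneg l2 c2 + 3 / 2 * l8 +
            93 / 20 * mul_nonneg l1 c5 + 124 / 5 * mul_nonneg l3 l5 +
            23299 / 200 * mul_nonneg l9 l11 + 37659 / 800 * mul_nonneg l6 l12 +
            2669 / 25 * mul_nonneg l0 l12 + 409 / 32 * mul_nonneg l6 t3 +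
            20111 / 200 * mul_nonneg l10 l11 + 3 * l10 + 12919 / 400 * mul_nonneg l7 l13 +
            20111 / 200 * mul_nonneg l10 l14 + 3409 / 400 * mul_nonneg l9 l13 +
            10083 / 100 * mul_nonneg l12 l13 + 228 / 25 * mul_nonneg l4 l12 +
            111 / 200 * mul_nonneg l11 c8 + 342 / 25 * mul_nonneg l15 t2 +
            1348 / 25 * mul_nonneg l3 l4 + 92 / 5 * l5 + 398 / 25 * mul_nonneg l0 t3 +
            711 / 200 * l11 + 6359 / 200 * mul_nonneg l2 l10 + 8633 / 800 * mul_nonneg l6 t1 +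
            1074 / 25 * mul_nonneg l0 c12 + 629 / 400 * mul_nonneg l1 c3
        · rw [← neg_nonneg] at t3
          linear_combination 100 * q + 96 * mul_nonneg l4 t1 + 37 / 3 * mul_nonneg l12 t3 +
            96 * mul_nonneg l2 l12 + 1 / 3 * mul_nonneg l13 t3 + 4 * mul_nonneg l1 c1 +
            472 / 3 * mul_nonneg l1 l13 + 4 * mul_nonneg l0 c5 + 8 * mul_nonneg l3 l4 +
            227 / 8 * mul_nonneg l10 l17 + 109 * mul_nonneg l3 l12 + 5 / 2 * mul_nonneg l1 c2 +
            3 * mul_nonneg l12 l13 + 293 / 4 * mul_nonneg l8 l15 + 8 * mul_nonneg l10 t1 +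
            323 / 4 * mul_nonneg l5 l10 + 164 / 3 * mul_nonneg l8 l11 +
              199 / 2 * mul_nonneg l6 l13 +
            190 / 3 * mul_nonneg l1 l12 + 442 / 3 * mul_nonneg l9 l11 +
              549 / 8 * mul_nonneg l7 l10 +
            52 * mul_nonneg l8 l9 + 317 / 6 * mul_nonneg l0 l14 + 104 * mul_nonneg l1 l15 +
            3 * mul_nonneg l13 c8 + 83 * mul_nonneg l0 l1 + 5 / 6 * mul_nonneg l6 t3 +
            6 * mul_nonneg l2 l7 + 53 / 3 * mul_nonneg l1 l7 + 1 / 2 * l6 +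
            175 / 3 * mul_nonneg l0 l7 + 563 / 3 * mul_nonneg l0 l6 + 2 * mul_nonneg l2 t2 +
            8 * mul_nonneg l3 l15 + 37 / 3 * mul_nonneg l1 l11 + 100 * mul_nonneg l10 l11 +
            8 * mul_nonneg l5 l6 + 83 / 2 * mul_nonneg l3 c7 + 263 / 3 * mul_nonneg l7 l11 +
            89 / 12 * mul_nonneg l7 l14 + 134 / 3 * mul_nonneg l11 c8 + 3 / 2 * l1 +
            205 / 6 * mul_nonneg l7 t3 + 3 * l15 + 101 / 2 * mul_nonneg l9 l15 +
            8 * mul_nonneg l5 l11 + 713 / 6 * mul_nonneg l1 l6 + 5 / 2 * mul_nonneg l6 l8 +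
            107 / 4 * mul_nonneg l14 t2 + 74 / 3 * mul_nonneg l3 l11 + 5 * mul_nonneg l8 l13 +
            61 / 6 * mul_nonneg l3 l14 + 2 * mul_nonneg l6 c8 + 5 * mul_nonneg l0 t2 +
            96 * mul_nonneg l9 l12 + 1 / 3 * mul_nonneg l11 t2 + 91 / 4 * mul_nonneg l15 t2 +
            3 / 2 * l8 + 4 * mul_nonneg l12 c4 + 107 * mul_nonneg l2 l3 + 52 * mul_nonneg l10 l14 +
            113 / 4 * mul_nonneg l8 l10 + 42 * l2 + 125 / 3 * l11 + 77 / 2 * l3 +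
            57 * mul_nonneg l1 t2 + 92 / 3 * mul_nonneg l0 l12 + 529 / 8 * mul_nonneg l9 l10 +
            176 * mul_nonneg l4 l5 + 8 * mul_nonneg l5 l13 + 2 * mul_nonneg l1 l2 +
            317 / 12 * mul_nonneg l13 l14 + 259 / 24 * mul_nonneg l14 c3 +
            95 / 2 * mul_nonneg l2 l15 + 8 * mul_nonneg l5 t0 + 8 * mul_nonneg l4 l15 +
            185 * mul_nonneg l10 l12 + 13 / 2 * mul_nonneg l3 l10 + 24 * mul_nonneg l2 l11 +
            365 / 6 * mul_nonneg l2 l14 + 48 * mul_nonneg l2 c2 + 772 / 3 * mul_nonneg l11 l12 +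
            88 * mul_nonneg l5 t1 + 52 * mul_nonneg l11 l14 + 2 * mul_nonneg l3 l13 +
            363 / 4 * mul_nonneg l12 l14 + 48 * mul_nonneg l9 l14 + 3 / 2 * mul_nonneg l10 c8 +
            1003 / 12 * mul_nonneg l1 l14 + 563 / 3 * mul_nonneg l0 l13 + 223 / 24 * l14 +
            mul_nonneg l2 l6
    · rw [← neg_nonneg] at t1
      linear_combination 100 * q + 159 / 2 * mul_nonneg l6 l7 + 100 * mul_nonneg l10 l11 +
        185 / 4 * mul_nonneg l9 l14 + 25 / 2 * mul_nonneg l1 t0 + 3 / 2 * mul_nonneg l7 c3 +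
        245 / 4 * mul_nonneg l11 l14 + 187 / 3 * mul_nonneg l2 l6 + 127 / 4 * mul_nonneg l11 l12 +
        1 / 4 * mul_nonneg l8 c11 + 42 / 5 * mul_nonneg l12 l15 + 184 / 3 * mul_nonneg l0 l2 +
        13 / 2 * mul_nonneg l6 c8 + 303 * mul_nonneg l2 l11 + 5 / 4 * mul_nonneg l7 l16 +
        3 / 2 * mul_nonneg l5 l6 + 101 / 8 * mul_nonneg l1 l10 + 251 / 2 * mul_nonneg l0 l6 +
        18 * mul_nonneg l7 l9 + 41 / 10 * l8 + 55 / 4 * mul_nonneg l1 l15 + 15 * mul_nonneg t0 t1 +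
        202 * mul_nonneg l2 l10 + 169 / 20 * mul_nonneg l12 l13 + 93 / 2 * mul_nonneg l2 l8 +
        7 / 4 * mul_nonneg l6 l9 + 337 / 6 * mul_nonneg l1 l2 + 149 * mul_nonneg l3 l4 +
        179 / 20 * mul_nonneg l3 l12 + 51 / 2 * mul_nonneg l1 t1 + 101 * mul_nonneg l2 l14 +
        205 / 6 * l2 + 245 / 4 * mul_nonneg l10 l14 + 3 / 2 * mul_nonneg l9 c5 +
        25 * mul_nonneg l3 c7 + 28 / 5 * mul_nonneg l8 l18 + 195 / 2 * mul_nonneg l0 l7 +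
        100 * mul_nonneg l6 l13 + 51 / 2 * mul_nonneg l1 l13 + 309 / 4 * mul_nonneg l9 l10 +
        179 / 20 * mul_nonneg l6 l12 + 10 * mul_nonneg l5 t0 + 1883 / 20 * mul_nonneg l8 l15 +
        592 / 5 * mul_nonneg l2 l12 + 33 / 4 * mul_nonneg l11 t0 + 27 / 4 * mul_nonneg l13 t0 +
        26 * mul_nonneg l1 l6 + 1753 / 20 * mul_nonneg l12 c11 + 46 * mul_nonneg l15 t1 +
        1 / 2 * mul_nonneg l3 c13 + 133 / 4 * mul_nonneg l8 l13 + 107 / 20 * mul_nonneg l8 c4 +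
        343 / 20 * mul_nonneg l12 t1 + 2 * mul_nonneg l7 l10 + 757 / 20 * mul_nonneg l8 t1 +
        1 / 2 * mul_nonneg l4 l12 + 10 * mul_nonneg l5 l10 + 92 * mul_nonneg l2 l13 +
        748 / 5 * mul_nonneg l4 l8 + 697 / 8 * mul_nonneg l1 c9 + 155 / 4 * mul_nonneg l14 l16 +
        655 / 4 * mul_nonneg l7 l13 + 51 / 4 * mul_nonneg l1 l11 + 73 / 20 * mul_nonneg l12 l14 +
        74 * mul_nonneg l2 l15 + 429 / 20 * mul_nonneg l1 l12 + 51 / 2 * l3 +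
        172 * mul_nonneg l4 l15 + 139 / 4 * mul_nonneg l8 l11 + 3451 / 20 * mul_nonneg l3 l8 +
        251 / 2 * mul_nonneg l0 l13 + 98 / 3 * mul_nonneg l2 t0 + 281 / 10 * mul_nonneg l10 l12 +
        3 / 2 * mul_nonneg l11 c8 + 205 / 6 * mul_nonneg l2 c15 + 15 / 4 * mul_nonneg l9 l18 +
        139 / 4 * mul_nonneg l11 l15 + 3 / 2 * mul_nonneg l10 c8 + 25 / 4 * mul_nonneg l10 l17 +
        133 / 4 * mul_nonneg l13 l15 + 1 / 8 * mul_nonneg l1 c18 + 1763 / 20 * l12 +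
        mul_nonneg l0 c5 + 5 * l6 + 641 / 4 * mul_nonneg l9 l11 + 189 / 20 * mul_nonneg l12 t0 +
        3 / 2 * mul_nonneg l13 c8 + 1 / 2 * mul_nonneg l6 t1 + 51 / 4 * mul_nonneg l1 l3 +
        145 / 2 * mul_nonneg l0 l18 + 347 / 4 * l1 + 272 * mul_nonneg l3 l15
  · rw [← neg_nonneg] at t0
    rcases le_total 0 (8 * a - 2 * u1 - 4 * u2 - 2 * u3 - 2 * u4 - 2 * u5 - 4 * u6 - 3 * v1 -
      3 * v2 - v5 - v6) with t1 | t1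
    · rcases le_total 0 (8 * a - 2 * u1 - 2 * u2 - 2 * u3 - 2 * u4 - 2 * u5 - 2 * u6 - 2 * v1 -
      3 * v2 - 2 * v3 - 3 * v4) with t2 | t2
      · linear_combination 100 * q + 133 / 2 * mul_nonneg l0 l18 + 2 / 3 * mul_nonneg l4 t0 +
          159 * mul_nonneg l1 l2 + 79 / 4 * mul_nonneg l4 l9 + 243 / 20 * mul_nonneg l3 l12 +
          2621 / 10 * mul_nonneg l3 l15 + 905 / 6 * mul_nonneg l2 l12 + 7 / 8 * mul_nonneg l8 l12 +
          249 / 20 * mul_nonneg l3 l13 + 249 / 40 * mul_nonneg l2 l3 + 31 / 4 * mul_nonneg l1 c9 +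
          182 * mul_nonneg l4 l15 + 659 / 2 * mul_nonneg l2 l11 + 629 / 6 * mul_nonneg l2 l14 +
          20 * mul_nonneg l17 t0 + 20 * mul_nonneg l7 l10 + 9 / 8 * mul_nonneg l12 c4 +
            3 / 8 * l10 +
          45 / 8 * mul_nonneg l1 l7 + 10 * mul_nonneg l4 l12 + 89 / 8 * mul_nonneg l9 l13 +
          199 / 8 * mul_nonneg l1 l15 + 7 / 8 * l6 + 255 / 4 * mul_nonneg l1 l4 +
          20 * mul_nonneg l11 l17 + 8 * mul_nonneg l0 l4 + 36 * mul_nonneg l7 l13 +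
          409 / 20 * mul_nonneg l3 t0 + 19 / 4 * mul_nonneg l0 c12 + 134 * mul_nonneg l1 l13 + l7 +
          13 / 2 * mul_nonneg l2 c4 + 1187 / 8 * mul_nonneg l1 l12 + 311 / 2 * mul_nonneg l11 l12 +
          184 * mul_nonneg l4 l8 + 45 / 4 * mul_nonneg l9 l18 + 187 / 2 * mul_nonneg l11 l14 +
          79 / 8 * mul_nonneg l7 l9 + 187 / 8 * mul_nonneg l1 t2 + 301 / 80 * mul_nonneg l3 c7 +
          7 / 4 * l17 + 327 / 8 * mul_nonneg l12 l14 + 11 / 2 * mul_nonneg l9 l10 +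
          4 * mul_nonneg l7 l15 + 4 * mul_nonneg l0 l14 + 265 / 4 * mul_nonneg l1 l14 +
          79 / 2 * mul_nonneg l2 t2 + 191 / 40 * l3 + 401 / 8 * l12 + 73 * mul_nonneg l0 l1 +
          7 / 4 * mul_nonneg l14 c10 + 77 / 80 * mul_nonneg l3 l10 + 641 / 8 * mul_nonneg l1 l6 +
          120 * mul_nonneg l0 l6 + 77 / 3 * mul_nonneg l2 t0 + 118 * mul_nonneg l0 l13 +
          33 / 4 * mul_nonneg l9 l11 + 5 * mul_nonneg l4 c8 + 59 / 2 * mul_nonneg l2 l13 +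
          100 * mul_nonneg l8 l15 + 483 / 80 * mul_nonneg l3 l14 + 10 * mul_nonneg l0 l12 +
          111 / 4 * mul_nonneg l9 t2 + 14739 / 80 * mul_nonneg l3 l8 + 3 / 8 * t1 +
          737 / 8 * mul_nonneg l1 l10 + mul_nonneg l15 c6 + 189 / 2 * mul_nonneg l10 l14 +
          4 * mul_nonneg l4 l14 + 69 / 4 * mul_nonneg l14 l17 + 3957 / 40 * mul_nonneg l1 l3 +
          741 / 80 * mul_nonneg l3 c13 + 163 / 8 * mul_nonneg l0 l3 + 11 / 6 * l2 +
          mul_nonneg l13 c6 + 6709 / 40 * mul_nonneg l3 l4 + 28 * mul_nonneg l7 t1 +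
          56 * mul_nonneg l12 c11 + 111 / 8 * mul_nonneg l9 l15 + 100 * mul_nonneg l10 l11 +
          11 / 4 * mul_nonneg l9 l17 + 5 / 3 * mul_nonneg l4 l17 + 1211 / 8 * mul_nonneg l1 l11 +
          965 / 8 * mul_nonneg l10 l12 + 20 * mul_nonneg l13 l17 + 4 * mul_nonneg l7 t0 +
          95 / 2 * mul_nonneg l2 t1 + 100 * mul_nonneg l6 l13 + 41 / 6 * mul_nonneg l2 c14 +
          10 * mul_nonneg l7 l12 + 48 * mul_nonneg l7 l11 + 2 * mul_nonneg l12 t2 +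
          1123 / 6 * mul_nonneg l2 l10 + 7 / 2 * mul_nonneg l2 l8 + mul_nonneg l11 c6 +
          16 * mul_nonneg l6 l7
      · rw [← neg_nonneg] at t2
        rcases le_total 0 (a - u1 - 3 * u4 + 3 * u5 - v1) with t3 | t3
        · linear_combination 100 * q + 152 / 3 * mul_nonneg l2 l14 + 128 / 3 * mul_nonneg l4 l6 +
            1075 / 144 * l18 + 210 * mul_nonneg l4 l15 + 4 / 3 * mul_nonneg l15 t2 +
            254 / 3 * mul_nonneg l2 l10 + 26 / 9 * mul_nonneg l12 t1 + 65 / 9 * mul_nonneg l3 c14 +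
            63 * mul_nonneg l6 l10 + 232 / 3 * mul_nonneg l12 l17 + 872 / 9 * mul_nonneg l2 l12 +
            275 / 3 * mul_nonneg l11 l14 + 1057 / 48 * mul_nonneg l7 l8 +
              2 / 3 * mul_nonneg l11 c20 +
            91 * mul_nonneg l10 l14 + 4859 / 72 * mul_nonneg l1 l18 + 88 / 3 * mul_nonneg l0 l15 +
            77 / 12 * mul_nonneg l0 l2 + 1075 / 144 * mul_nonneg l18 c11 +
            224 / 3 * mul_nonneg l10 l17 + 1607 / 72 * mul_nonneg l7 l10 +
            26 / 3 * mul_nonneg l11 l15 + 67 / 54 * mul_nonneg l6 t3 + 214 / 3 * mul_nonneg l0 l1 +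
            2651 / 144 * mul_nonneg l10 l18 + 379 / 8 * mul_nonneg l7 l15 + 34 * mul_nonneg l0 l8 +
            25 / 3 * mul_nonneg l11 c6 + 2495 / 144 * mul_nonneg l7 l14 +
            1759 / 24 * mul_nonneg l2 l15 + 2495 / 36 * mul_nonneg l2 l8 + 8 * mul_nonneg l1 c9 +
            3173 / 54 * mul_nonneg l6 l13 + 133 / 18 * mul_nonneg l3 c20 +
            7 / 12 * mul_nonneg l18 t1 + 95 / 8 * mul_nonneg l2 t3 + 1121 / 36 * mul_nonneg l3 t3 +
            1630 / 9 * mul_nonneg l10 l12 + 460 / 3 * mul_nonneg l2 l11 + 77 * mul_nonneg l1 l10 +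
            133 / 36 * mul_nonneg l3 c21 + 641 / 18 * mul_nonneg l11 l18 +
            8 / 3 * mul_nonneg l15 c20 + 4 * mul_nonneg l0 c5 + 1399 / 36 * mul_nonneg l1 l3 +
            184 / 3 * mul_nonneg l6 l17 + 26 * mul_nonneg l6 l8 + 164 * mul_nonneg l1 l12 +
            2 / 3 * mul_nonneg l8 l10 + 371 / 24 * mul_nonneg l18 t0 + 232 / 3 * mul_nonneg l0 l6 +
            650 / 3 * mul_nonneg l4 l8 + 602 / 9 * mul_nonneg l12 l14 + 9 / 2 * mul_nonneg l14 c20 +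
            9 / 2 * mul_nonneg l10 c5 + 2393 / 144 * mul_nonneg l14 l18 +
              56 / 3 * mul_nonneg l1 l4 +
            134 / 3 * mul_nonneg l6 l15 + 4367 / 144 * mul_nonneg l7 t1 + 9 * mul_nonneg l3 l11 +
            16 * mul_nonneg l15 l17 + mul_nonneg l15 c6 + 3731 / 36 * mul_nonneg l3 l8 +
            2495 / 36 * mul_nonneg l7 l11 + 927 / 8 * mul_nonneg l1 l2 +
            1457 / 24 * mul_nonneg l4 l7 + 53 / 3 * mul_nonneg l8 l17 +
            3053 / 72 * mul_nonneg l2 c14 + 80 * mul_nonneg l1 l13 + 9 / 2 * l8 +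
            2420 / 9 * mul_nonneg l11 l12 + 77 / 72 * mul_nonneg l18 t3 + 10 * mul_nonneg l12 c21 +
            81 * mul_nonneg l6 l11 + 60 * mul_nonneg l1 l14 + 5039 / 72 * mul_nonneg l18 t2 +
            2189 / 72 * l2 + 29 / 3 * l15 + 1295 / 36 * mul_nonneg l2 l4 +
            758 / 9 * mul_nonneg l0 l18 + 3359 / 36 * mul_nonneg l3 l15 + 27 * mul_nonneg l6 l14 +
            394 / 3 * mul_nonneg l11 l17 + 601 / 18 * mul_nonneg l3 c13 +
              25 / 3 * mul_nonneg l8 l12 +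
            114 * mul_nonneg l0 l13 + 1645 / 36 * l3 + 197 / 3 * mul_nonneg l14 l17 +
            25 / 3 * mul_nonneg l10 t2 + 130 / 3 * mul_nonneg l0 t2 + 3 / 2 * l6 +
            91 * mul_nonneg l10 l11 + 17 / 3 * mul_nonneg l17 t3 + 3 * l7 +
              37 * mul_nonneg l13 l17 +
            307 / 3 * mul_nonneg l8 l15 + 139 / 18 * mul_nonneg l13 l18 + 146 * mul_nonneg l1 l11
        · rw [← neg_nonneg] at t3
          linear_combination 100 * q + 105373 / 1089 * mul_nonneg l10 l11 +
            8153 / 363 * mul_nonneg l7 t1 + 172937 / 2178 * mul_nonneg l14 l17 +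
            4355 / 363 * mul_nonneg l4 l14 + 5900 / 121 * mul_nonneg l14 l18 +
            1711 / 66 * mul_nonneg l7 l10 + 7379 / 242 * mul_nonneg l6 l13 +
              44 * mul_nonneg l6 l17 +
            3163 / 484 * mul_nonneg l10 c20 + 11504 / 121 * mul_nonneg l10 l17 +
            9673 / 726 * mul_nonneg l14 l15 + 167 / 198 * mul_nonneg l11 c14 +
            5121 / 242 * mul_nonneg l1 c9 + 5658 / 121 * mul_nonneg l0 l6 + 36469 / 4356 * l14 +
            22453 / 2178 * l11 + 18155 / 121 * mul_nonneg l4 l8 + 1558 / 363 * mul_nonneg l2 l17 +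
            3911 / 242 * l1 + 225 / 121 * mul_nonneg l13 c13 + 200018 / 1089 * mul_nonneg l11 l17 +
            50969 / 2178 * mul_nonneg l6 l14 + 6 * mul_nonneg l3 c13 +
            21191 / 242 * mul_nonneg l11 l14 + 4955 / 363 * mul_nonneg l4 l17 +
            18519 / 121 * mul_nonneg l4 l15 + 3895 / 363 * mul_nonneg l14 c20 +
            5098 / 121 * mul_nonneg l2 l12 + 1711 / 484 * l10 + 2386 / 363 * mul_nonneg l15 c0 +
            16201 / 363 * mul_nonneg l4 l18 + 779 / 363 * mul_nonneg l2 l10 +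
            575 / 121 * mul_nonneg l10 t3 + 2797 / 4356 * mul_nonneg l14 c17 +
            7499 / 726 * mul_nonneg l6 l15 + 24074 / 363 * mul_nonneg l0 l18 +
            6173 / 121 * mul_nonneg l4 t3 + 4955 / 363 * mul_nonneg l4 t0 + 225 / 121 * l13 +
            1965 / 121 * mul_nonneg l0 l3 + 250 / 11 * mul_nonneg l1 l4 +
            1193 / 121 * mul_nonneg l8 c12 + 1721 / 121 * mul_nonneg l7 l13 +
            5694 / 121 * mul_nonneg l7 l11 + 10808 / 363 * mul_nonneg l6 l8 +
            10639 / 726 * mul_nonneg l7 l8 + 16306 / 363 * mul_nonneg l3 l7 +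
            7742 / 1089 * mul_nonneg l14 t3 + 169 / 363 * mul_nonneg l8 t2 +
            34964 / 363 * mul_nonneg l1 l18 + 779 / 726 * mul_nonneg l1 l14 +
            6979 / 121 * mul_nonneg l1 l3 + 1150 / 121 * mul_nonneg l11 t3 +
            13126 / 363 * mul_nonneg l0 l2 + 5614 / 363 * mul_nonneg l11 c20 +
            45890 / 363 * mul_nonneg l2 l4 + 3947 / 121 * mul_nonneg l6 l7 +
            17794 / 121 * mul_nonneg l0 l13 + 6563 / 363 * mul_nonneg l12 t1 +
            324572 / 1089 * mul_nonneg l11 l12 + 2833 / 66 * mul_nonneg l8 l13 +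
            255 / 11 * mul_nonneg l8 l12 + 3209 / 33 * mul_nonneg l15 t3 +
            14065 / 121 * mul_nonneg l0 l1 + 76075 / 1089 * mul_nonneg l2 l13 +
            7 * mul_nonneg l12 c21 + 3 * mul_nonneg l4 c5 + 11477 / 363 * mul_nonneg l13 l18 +
            5900 / 121 * mul_nonneg l10 l18 + 18155 / 242 * mul_nonneg l8 t3 +
            35632 / 1089 * mul_nonneg l2 t3 + mul_nonneg l0 c5 + 2659 / 363 * mul_nonneg l8 l10 +
            11800 / 121 * mul_nonneg l11 l18 + 2386 / 363 * l15 + 39025 / 363 * mul_nonneg l6 l11 +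
            19936 / 1089 * mul_nonneg l12 t3 + 16371 / 121 * mul_nonneg l1 l13 +
            39052 / 363 * mul_nonneg l15 l18 + 8963 / 363 * mul_nonneg l8 l18 +
            1739 / 363 * mul_nonneg l15 t0 + 149459 / 726 * mul_nonneg l10 l12 +
            254 / 121 * mul_nonneg l4 l12 + 3 * l18 + 19467 / 121 * mul_nonneg l2 l15 +
            9456 / 121 * mul_nonneg l6 l10 + 43706 / 363 * mul_nonneg l2 l8 +
            21605 / 363 * mul_nonneg l1 l2 + 1193 / 121 * l8 + 7499 / 363 * mul_nonneg l15 t2 +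
            36968 / 363 * mul_nonneg l18 t2 + 112 * mul_nonneg l12 l17 +
            8704 / 121 * mul_nonneg l12 l14 + 397 / 1089 * mul_nonneg l12 l13 +
            183665 / 2178 * mul_nonneg l10 l14 + 14104 / 363 * l2 + 9491 / 121 * mul_nonneg l1 l12 +
            17371 / 363 * mul_nonneg l2 c14 + 30982 / 363 * mul_nonneg l8 l15 +
            35 * mul_nonneg l0 t2
    · rw [← neg_nonneg] at t1
      rcases le_total 0 (8 * a - 2 * u1 - 2 * u2 - 2 * u3 - 2 * u4 - 2 * u5 - 2 * u6 - 3 * v1 -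
        3 * v2 - 2 * v3 - 2 * v4 + v5 + v6) with t2 | t2
      · rcases le_total 0 (8 * a - 2 * u1 - 4 * u2 - 2 * u3 - 2 * u4 - 2 * u5 - 2 * u6 - 3 * v1 -
        3 * v2 - v4 - v6) with t3 | t3
        · linear_combination 100 * q + 882 / 17 * mul_nonneg l2 t3 +
          27329 / 204 * mul_nonneg l2 l12 +
            3845 / 204 * mul_nonneg l12 t2 + 16 / 17 * l7 + 3 * mul_nonneg l4 l14 +
            215 / 17 * mul_nonneg l9 l10 + 2594 / 17 * mul_nonneg l0 l13 + 3563 / 102 * l12 +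
            15020 / 119 * mul_nonneg l1 l2 + 8701 / 34 * mul_nonneg l3 l15 +
            2475 / 17 * mul_nonneg l4 l8 + 313 / 2 * mul_nonneg l3 l4 +
              211 / 6 * mul_nonneg l11 l17 +
            626 / 17 * mul_nonneg l14 l16 + 2051 / 17 * mul_nonneg l12 l13 +
            147 / 17 * mul_nonneg l0 l14 + 426 / 17 * mul_nonneg l3 l11 +
            536 / 51 * mul_nonneg l2 t0 + 138 / 17 * mul_nonneg l3 c16 +
              628 / 7 * mul_nonneg l1 l13 +
            147 / 17 * mul_nonneg l0 l15 + 1177 / 34 * mul_nonneg l4 l9 + 13 / 34 * l9 +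
            583 / 34 * mul_nonneg l6 l7 + 108 / 17 * mul_nonneg l10 l15 +
            797 / 68 * mul_nonneg l9 t1 + 14897 / 204 * mul_nonneg l6 l12 +
            1745 / 34 * mul_nonneg l11 l14 + 792 / 17 * mul_nonneg l2 l14 +
            1503 / 34 * mul_nonneg l10 l14 + 8595 / 238 * mul_nonneg l1 l11 +
            675 / 34 * mul_nonneg l3 l14 + 519 / 34 * mul_nonneg l3 t0 +
            12273 / 68 * mul_nonneg l3 l8 + 9545 / 119 * mul_nonneg l1 l6 +
            3671 / 51 * mul_nonneg l3 l12 + 57 / 34 * mul_nonneg l11 c6 +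
            3355 / 34 * mul_nonneg l8 l15 + 5427 / 238 * mul_nonneg l1 c1 + 183 / 68 * l3 +
            4769 / 408 * mul_nonneg l2 c15 + 1268 / 51 * mul_nonneg l0 l17 +
            53 / 3 * mul_nonneg l17 t0 + 384 / 17 * mul_nonneg l0 l4 +
            139187 / 714 * mul_nonneg l1 l12 + 492 / 17 * mul_nonneg l2 c2 +
            1306 / 51 * mul_nonneg l13 l17 + 32 / 17 * l6 + 20143 / 238 * mul_nonneg l1 l3 +
            237 / 34 * mul_nonneg l12 l14 + 2475 / 17 * mul_nonneg l4 l15 + 3159 / 238 * l1 +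
            13 / 17 * l10 + 40 / 51 * mul_nonneg l15 l17 + 384 / 17 * mul_nonneg l2 l6 +
            309 / 68 * mul_nonneg l3 c7 + 5519 / 204 * mul_nonneg l2 t2 +
            2639 / 17 * mul_nonneg l0 l6 + 166 / 17 * mul_nonneg l9 l12 +
            5413 / 238 * mul_nonneg l1 t2 + 14461 / 204 * mul_nonneg l2 l11 +
            3445 / 34 * mul_nonneg l6 l13 + 10745 / 408 * l2 + 103 / 3 * mul_nonneg l2 l3 +
            3593 / 102 * mul_nonneg l12 c11 + 5468 / 119 * mul_nonneg l1 l14 +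
            178 / 17 * mul_nonneg l6 l10 + 12901 / 102 * mul_nonneg l0 l12 +
            135 / 17 * mul_nonneg l16 t1 + 1648 / 51 * mul_nonneg l2 l4 +
            6446 / 119 * mul_nonneg l1 l4 + 223 / 17 * mul_nonneg l10 l13 +
            299 / 34 * mul_nonneg l12 c4 + 65 / 17 * mul_nonneg l6 l9 +
            862 / 51 * mul_nonneg l10 l17 + 1225 / 34 * mul_nonneg l3 l9 +
            1025 / 204 * mul_nonneg l10 l12 + 395 / 17 * mul_nonneg l4 c8 +
            402 / 17 * mul_nonneg l7 t3 + 39 / 34 * mul_nonneg l4 c19 +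
            2449 / 102 * mul_nonneg l9 l17 + 1419 / 68 * mul_nonneg l9 t2 +
            576 / 17 * mul_nonneg l0 l3 + 313 / 34 * mul_nonneg l9 l15 +
            350 / 17 * mul_nonneg l0 l18 + 2933 / 102 * mul_nonneg l4 l12 +
            5265 / 119 * mul_nonneg l0 l1 + 98 / 51 * mul_nonneg l4 l17 + 637 / 34 * l4 +
            29 * mul_nonneg l7 l13 + 81 / 17 * mul_nonneg l0 c12 + 282 / 17 * mul_nonneg l9 l18 +
            401 / 34 * mul_nonneg l7 l15 + 83 / 34 * mul_nonneg l14 c10 +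
            5473 / 238 * mul_nonneg l1 l15 + 114 / 17 * mul_nonneg l8 l10 +
            3115 / 34 * mul_nonneg l10 l11 + 1125 / 68 * mul_nonneg l2 l8 +
            7 / 17 * mul_nonneg l10 t3 + 2131 / 119 * mul_nonneg l1 t3 +
              45 / 34 * mul_nonneg l15 c6 +
            48 / 17 * l17
        · rw [← neg_nonneg] at t3
          linear_combination 100 * q + 8 * mul_nonneg l2 l6 + 20 / 3 * mul_nonneg l2 l13 +
            80 / 3 * mul_nonneg l3 l12 + 40 / 3 * mul_nonneg l0 l12 + 8 * mul_nonneg l6 l9 +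
            200 * mul_nonneg l0 l17 + 60 * mul_nonneg l1 l2 + 92 * mul_nonneg l6 l13 +
            200 * mul_nonneg l4 l8 + 102 * mul_nonneg l10 l13 + 20 / 3 * mul_nonneg l0 l3 +
            100 / 9 * mul_nonneg l10 l14 + 3 / 2 * l10 + 40 / 9 * mul_nonneg l14 c10 +
            174 * mul_nonneg l1 l6 + 20 / 9 * mul_nonneg l9 l14 + 20 / 3 * mul_nonneg l8 l16 +
            40 * mul_nonneg l9 l12 + 34 * mul_nonneg l10 l17 + 712 / 3 * mul_nonneg l1 l13 +
            194 / 3 * l2 + 160 / 3 * mul_nonneg l1 l12 + 13 * l12 + 284 / 3 * mul_nonneg l3 l9 +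
            53 / 18 * l14 + 100 / 3 * mul_nonneg l9 t2 + 10 * mul_nonneg l0 c19 +
            14 * mul_nonneg l1 c18 + 20 / 3 * mul_nonneg l0 l14 + 8 / 3 * mul_nonneg l6 c16 +
            200 / 3 * mul_nonneg l4 l9 + 320 / 3 * mul_nonneg l11 l12 + 68 * mul_nonneg l0 l10 +
            5 / 6 * l6 + 58 / 3 * mul_nonneg l9 l10 + 100 * mul_nonneg l8 l15 + 3 * l9 +
            108 * mul_nonneg l6 l17 + 112 * mul_nonneg l0 l1 + 200 * mul_nonneg l4 l15 +
            560 / 3 * mul_nonneg l12 l16 + 132 * mul_nonneg l1 l17 + 140 / 3 * mul_nonneg l10 l11 +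
            8 * mul_nonneg l6 l8 + 8 * mul_nonneg l6 l15 + 8 / 3 * mul_nonneg l6 c3 + 9 / 2 * l8 +
            58 * mul_nonneg l10 l15 + 80 / 3 * mul_nonneg l12 t3 + 200 / 3 * mul_nonneg l12 l14 +
            484 / 3 * mul_nonneg l3 l4 + 242 * mul_nonneg l3 l8 + 20 * mul_nonneg l2 l17 +
            80 / 3 * mul_nonneg l2 l11 + 40 / 3 * mul_nonneg l13 c19 +
              340 / 9 * mul_nonneg l11 l14 +
            3 * l1 + 60 * mul_nonneg l14 l16 + 20 * mul_nonneg l12 c11 + 200 * mul_nonneg l0 l13 +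
            968 / 3 * mul_nonneg l3 l15 + 136 / 3 * mul_nonneg l6 l16 + 40 / 3 * mul_nonneg l1 l4 +
            80 * mul_nonneg l16 t3 + 40 / 3 * mul_nonneg l16 t1 + 230 / 3 * mul_nonneg l2 c15 +
            76 * mul_nonneg l6 l10 + 160 / 3 * mul_nonneg l1 l3 + 20 / 3 * mul_nonneg l1 t2 +
            116 / 3 * mul_nonneg l8 l10 + 184 * mul_nonneg l0 l6 + 280 / 3 * mul_nonneg l0 l16 +
            80 * mul_nonneg l13 l16 + 8 / 3 * mul_nonneg l6 l14 + 20 / 3 * mul_nonneg l16 t2 +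
            6 * mul_nonneg l3 c16 + 116 / 3 * mul_nonneg l4 l10 + 200 * mul_nonneg l13 l17 +
            40 / 9 * mul_nonneg l14 t0 + 13 / 3 * l13 + 6 * l15 + 80 / 3 * mul_nonneg l2 l3 +
            80 / 3 * mul_nonneg l14 t3 + 80 / 3 * mul_nonneg l2 l12
      · rw [← neg_nonneg] at t2
        rcases le_total 0 (-2 * a + u2 + u3 + u4 + u5 + u6 + v1 + v2 - v3 - v4) with t3 | t3
        · linear_combination 100 * q + 8 * mul_nonneg l1 c18 + 598 / 27 * mul_nonneg l11 l17 +
            5126 / 27 * mul_nonneg l0 l13 + 79 / 18 * mul_nonneg l11 l16 +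
            914 / 27 * mul_nonneg l0 l10 + 4802 / 27 * mul_nonneg l0 l6 +
            2531 / 27 * mul_nonneg l6 l13 + 2534 / 27 * mul_nonneg l3 l4 + 216 * mul_nonneg l1 l6 +
            2500 / 27 * mul_nonneg l4 l8 + 4 * mul_nonneg l12 c11 + 3899 / 54 * mul_nonneg l3 l11 +
            554 / 27 * mul_nonneg l13 l16 + 8129 / 27 * mul_nonneg l1 l13 +
            1739 / 27 * mul_nonneg l10 l13 + 49 / 9 * mul_nonneg l3 l14 +
            775 / 18 * mul_nonneg l11 l12 + 250 / 27 * mul_nonneg l6 l8 + 977 / 108 * l4 +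
            144 * mul_nonneg l1 l17 + 440 / 27 * mul_nonneg l0 l2 + 101 / 108 * mul_nonneg l4 c20 +
            200 / 9 * mul_nonneg l1 l3 + 5068 / 27 * mul_nonneg l3 l15 + 52 * mul_nonneg l12 l16 +
            1423 / 18 * mul_nonneg l15 l16 + 1400 / 27 * mul_nonneg l8 l15 +
            161 / 54 * mul_nonneg l4 l6 + 4 / 3 * mul_nonneg l10 l16 +
              295 / 54 * mul_nonneg l13 c17 +
            920 / 9 * mul_nonneg l4 l15 + 4108 / 27 * mul_nonneg l0 l1 +
              509 / 9 * mul_nonneg l3 t2 +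
            80 * mul_nonneg l1 l12 + 2440 / 27 * mul_nonneg l2 l12 +
              2051 / 108 * mul_nonneg l15 c4 +
            641 / 27 * l11 + 1640 / 27 * mul_nonneg l4 t2 + 28 * mul_nonneg l10 l17 +
            128 / 3 * mul_nonneg l6 l10 + 641 / 27 * mul_nonneg l11 c18 +
              47 / 9 * mul_nonneg l4 t0 +
            5051 / 27 * mul_nonneg l13 l17 + 6865 / 54 * mul_nonneg l4 l16 +
            520 / 27 * mul_nonneg l3 l12 + 20 / 3 * mul_nonneg l16 t0 +
            2702 / 27 * mul_nonneg l8 l10 + 1310 / 27 * mul_nonneg l3 c16 +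
            260 / 3 * mul_nonneg l16 t3 + 560 / 27 * mul_nonneg l2 l8 +
              7 / 54 * mul_nonneg l13 c20 +
            320 / 27 * mul_nonneg l1 l8 + 61 / 6 * mul_nonneg l15 c0 + 3 * l16 +
            119 / 9 * mul_nonneg l6 l11 + 11 / 27 * mul_nonneg l13 c10 +
              40 / 3 * mul_nonneg l6 l12 +
            2123 / 108 * mul_nonneg l11 t2 + 3374 / 27 * mul_nonneg l3 l8 +
            20 / 3 * mul_nonneg l14 l17 + 382 / 27 * mul_nonneg l2 l13 +
            7571 / 108 * mul_nonneg l15 t2 + 1861 / 27 * mul_nonneg l11 l15 +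
            100 / 9 * mul_nonneg l4 c15 + 4802 / 27 * mul_nonneg l0 l17 + 1271 / 27 * l3 +
            217 / 18 * mul_nonneg l6 l15 + 20 / 3 * mul_nonneg l6 c10 + 56 * mul_nonneg l12 l14 +
            7 * mul_nonneg l0 c17 + 1760 / 27 * mul_nonneg l2 c15 + 1091 / 27 * mul_nonneg l12 l13 +
            1879 / 36 * mul_nonneg l11 l14 + 9089 / 108 * mul_nonneg l8 l11 +
            62 / 27 * mul_nonneg l0 l4 + 280 / 3 * mul_nonneg l6 l17 + 41 / 9 * mul_nonneg l3 c7 +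
            2849 / 54 * mul_nonneg l4 l5 + 11 / 54 * mul_nonneg l15 c6 + 40 * mul_nonneg l1 l2 +
            260 / 27 * mul_nonneg l2 t2 + 371 / 27 * mul_nonneg l4 t1 + 1517 / 27 * l2 +
            1057 / 36 * l15 + 92 / 3 * mul_nonneg l10 l14 + 40 / 3 * mul_nonneg l14 t3 +
            48 * mul_nonneg l9 l10 + 20 * mul_nonneg l2 l14 + 970 / 27 * mul_nonneg l8 t2 +
            40 * mul_nonneg l0 l16 + 80 / 27 * mul_nonneg l1 l15 + 11 / 3 * l6 +
            40 / 27 * mul_nonneg l3 l17 + 487 / 27 * mul_nonneg l11 l13 +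
            1300 / 27 * mul_nonneg l8 l9 + 1955 / 36 * mul_nonneg l10 l15 +
            947 / 27 * mul_nonneg l10 l11 + 1300 / 27 * mul_nonneg l0 l12
        · rw [← neg_nonneg] at t3
          linear_combination 100 * q + 725 / 11 * mul_nonneg l10 l14 + 200 / 3 * mul_nonneg l18 t3 +
            72942 / 1309 * mul_nonneg l4 c8 + 973 / 33 * l15 + 14560 / 99 * mul_nonneg l1 l2 +
            619943 / 4488 * mul_nonneg l3 l4 + 466321 / 8976 * mul_nonneg l3 t2 +
            75364 / 3927 * mul_nonneg l4 l12 + 3055 / 33 * mul_nonneg l6 l13 +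
            3935 / 33 * mul_nonneg l0 l6 + 955 / 33 * mul_nonneg l7 l8 +
            2108 / 33 * mul_nonneg l8 l11 + 490 / 33 * mul_nonneg l6 l14 +
            135997 / 8976 * mul_nonneg l3 l14 + 86329 / 7854 * mul_nonneg l4 c19 +
            515 / 66 * mul_nonneg l12 c21 + 111439 / 1683 * mul_nonneg l2 l14 + 97 / 44 * l18 +
            1846 / 153 * mul_nonneg l2 l10 + 17794 / 1683 * mul_nonneg l2 t0 +
            45846 / 1309 * mul_nonneg l4 t1 + 3163 / 198 * mul_nonneg l8 t1 +
            151595 / 3927 * mul_nonneg l4 l15 + 1805 / 22 * mul_nonneg l10 l13 +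
            173651 / 7854 * mul_nonneg l4 l11 + 160943 / 4488 * mul_nonneg l3 t1 + 941 / 132 * l11 +
            13 / 99 * mul_nonneg l11 l17 + 40583 / 4488 * mul_nonneg l3 c13 +
            755 / 99 * mul_nonneg l2 l6 + 1475 / 11 * mul_nonneg l0 l13 +
            2006 / 99 * mul_nonneg l8 l10 + 2467 / 33 * mul_nonneg l0 l1 +
            195 / 11 * mul_nonneg l10 t2 + 1175 / 66 * mul_nonneg l2 l8 +
            17266 / 99 * mul_nonneg l13 l17 + 9368 / 99 * mul_nonneg l6 l17 +
            251 / 99 * mul_nonneg l8 c12 + 526 / 11 * mul_nonneg l1 l14 +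
            1205 / 132 * mul_nonneg l11 c18 + 3 * mul_nonneg l0 c17 + 7412 / 99 * mul_nonneg l0 l2 +
            182 / 9 * mul_nonneg l14 l17 + 3991 / 198 * mul_nonneg l17 t1 +
            5570 / 33 * mul_nonneg l1 l12 + 3253 / 198 * mul_nonneg l10 l17 +
            3046 / 33 * mul_nonneg l11 l15 + 2282 / 99 * mul_nonneg l3 l17 + 25283 / 2244 * l2 +
              l6 +
            390 / 11 * mul_nonneg l11 l18 + 53 / 132 * t3 + 1030 / 33 * mul_nonneg l11 l12 +
            896 / 33 * mul_nonneg l7 l15 + 515 / 33 * mul_nonneg l1 l18 +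
            169 / 22 * mul_nonneg l6 l8 + 37678 / 1683 * mul_nonneg l2 c14 +
            1685 / 66 * mul_nonneg l6 t1 + 21557 / 1309 * mul_nonneg l4 t2 +
            1295 / 22 * mul_nonneg l10 l12 + 56997 / 748 * mul_nonneg l1 l3 +
            735344 / 11781 * mul_nonneg l4 l8 + 145 / 198 * l8 + 65497 / 2992 * mul_nonneg l3 c7 +
            490 / 33 * mul_nonneg l1 l13 + 68047 / 1122 * l4 + 45251 / 187 * mul_nonneg l3 l15 +
            1255 / 66 * mul_nonneg l6 l11 + 530 / 11 * mul_nonneg l11 l14 +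
            39505 / 2244 * mul_nonneg l3 l12 + 10741 / 99 * mul_nonneg l0 l17 +
            2006 / 99 * mul_nonneg l8 l9 + 721 / 22 * mul_nonneg l15 t2 +
            1613 / 66 * mul_nonneg l15 t1 + 169 / 11 * mul_nonneg l15 c6 +
            56101 / 3927 * mul_nonneg l4 l6 + 493 / 11 * mul_nonneg l1 l15 +
              2 * mul_nonneg l14 c17 +
            2060 / 33 * mul_nonneg l6 l10 + 254893 / 1683 * mul_nonneg l3 l8 +
            515 / 66 * mul_nonneg l1 c9 + 5635 / 132 * mul_nonneg l11 t2 +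
            248 / 9 * mul_nonneg l1 l8 + 1669 / 66 * mul_nonneg l8 t2 + 5801 / 272 * l3 +
            725 / 22 * mul_nonneg l13 t1 + 6122 / 99 * mul_nonneg l8 l15 + 730 / 99 * l17 +
            360 / 11 * mul_nonneg l0 l10 + 48591 / 1309 * mul_nonneg l1 l4 +
            1952 / 33 * mul_nonneg l0 l12 + 459389 / 3366 * mul_nonneg l2 l12 +
            920 / 11 * mul_nonneg l10 l11 + 95009 / 2244 * mul_nonneg l0 l3 +
            532 / 99 * mul_nonneg l17 c9 + 10001 / 6732 * mul_nonneg l2 c15 +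
            3671 / 66 * mul_nonneg l12 l14 + 3239 / 1122 * mul_nonneg l2 t2 +
            2116 / 3927 * mul_nonneg l4 c20 + 195 / 11 * mul_nonneg l15 c0

theorem lorentz_apply (u v : Fin 13 → ℤ) : lorentz u v =
    2 * (u 0 * v 0) - 2 * (u 1 * v 1 + u 2 * v 2 + u 3 * v 3 + u 4 * v 4 + u 5 * v 5 + u 6 * v 6) -
      (u 7 * v 7 + u 8 * v 8 + u 9 * v 9 + u 10 * v 10 + u 11 * v 11 + u 12 * v 12) := by
  simp [lorentz, Fin.sum_univ_succ, frameWeight]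
  ring

set_option maxHeartbeats 2000000 in
/-- Vectors of norm `2` in the fundamental chamber have bounded height. -/
theorem height_le_of_chamber {u : Fin 13 → ℤ} (hu : lorentz u u = 2) (h0 : 0 < u 0)
    (hroot : ∀ i, 0 ≤ lorentz u (frameRoot i)) : u 0 ≤ 200 := by
  have hcusp (k) : 0 < lorentz u (frameCusp k) := by
    have h : ∀ k, 0 ≤ lorentz (frameCusp k) (frameCusp k) ∧ 0 < frameCusp k 0 := by
      decide +kernel
    exact lorentz_pos (by omega) (h k).1 h0 (h k).2
  simp [lorentz_apply, frameRoot, Fin.forall_fin_succ] at hroot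
  simp [lorentz_apply, frameCusp, Fin.forall_fin_succ] at hcusp
  rw [lorentz_apply] at hu
  obtain ⟨l0, l1, l2, l3, l4, l5, l6, l7, l8, l9,
    l10, l11, l12, l13, l14, l15, l16, l17, l18⟩ := hroot
  obtain ⟨c0, c1, c2, c3, c4, c5, c6, c7, c8, c9, c10, c11, c12,
    c13, c14, c15, c16, c17, c18, c19, c20, c21⟩ := hcusp
  have h : (u 0 : ℚ) ≤ 200 := by
    apply height_le (u1 := u 1) (u2 := u 2) (u3 := u 3) (u4 := u 4) (u5 := u 5) (u6 := u 6)
      (v1 := u 7) (v2 := u 8) (v3 := u 9) (v4 := u 10) (v5 := u 11) (v6 := u 12)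
    all_goals norm_cast
    all_goals linarith
  exact_mod_cast h

theorem exists_mem_Wr_height_le {x : Fin 13 → ℤ} (hx : bform gram13 x x = 2)
    (h0 : 0 < (frameMatrix *ᵥ x) 0) :
    ∃ w ∈ Wr 13 gram13, |(frameMatrix *ᵥ (w • x)) 0| ≤ 200 := by
  obtain ⟨w, hw, hpos, hc⟩ := exists_mem_Wr_chamber hx h0
  refine ⟨w, hw, ?_⟩
  rw [abs_of_pos hpos]
  refine height_le_of_chamber ?_ hpos fun i => ?_
  · rw [← bform_gram13, bform_smul_smul, hx]
  · rw [← frameMatrix_mulVec_simpleRoot, ← bform_gram13]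
    exact hc i

/-- The lattice `U ⊕ D₄ ⊕ A₁⁷` is reflective: the subgroup `W_r` of `O(S)`
generated by the reflections in all roots has finite index in `O(S)`. -/
theorem reflective_13_9_1 : (Wr _ gramS).FiniteIndex := by
  change (Wr 13 gram13).FiniteIndex
  refine (Wr 13 gram13).finiteIndex_of_orbit finite_stabilizer_axis
    (finite_setOf_bform_self_eq 200 2) fun g => ?_
  set x := g • axis
  have hx : bform gram13 x x = 2 := (bform_smul_smul g axis axis).trans (by decide +kernel)
  suffices ∃ w ∈ Wr 13 gram13, |(frameMatrix *ᵥ (w • x)) 0| ≤ 200 by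
    obtain ⟨w, hw, h⟩ := this
    exact ⟨w, hw, h, (bform_smul_smul w x x).trans hx⟩
  rcases lt_trichotomy ((frameMatrix *ᵥ x) 0) 0 with h | h | h
  · obtain ⟨w, hw, h⟩ := exists_mem_Wr_height_le (x := -x)
      (by rw [bform_neg_left, bform_comm gram13_isSymm, bform_neg_left, neg_neg, hx])
      (by simpa [mulVec_neg] using h)
    exact ⟨w, hw, by simpa [mulVec_neg] using h⟩
  · have := lorentz_self_le (frameMatrix *ᵥ x)
    rw [← bform_gram13, hx, h] at this
    omega
  · exact exists_mem_Wr_height_le hx h
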